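/- Let α > 0 and let h be a sequence of complex numbers with h(j) = j^{−1}(log j)^{−α} for all sufficiently large j. Then for every m ≥ 1 the iterated difference sequence satisfies h^{(m)}(j) = O(j^{−1−m}(log j)^{−α}) as j → ∞. -/

import Mathlib

open Filter
open scoped Topology Real

noncomputable section

/-- Iterated differences of a sequence: `h⁽⁰⁾ = h`,
`h⁽ᵐ⁺¹⁾(j) = h⁽ᵐ⁾(j+1) − h⁽ᵐ⁾(j)`. -/
def diffIter (h : ℕ → ℂ) : ℕ → ℕ → ℂ
  | 0 => h
  | m + 1 => fun j => diffIter h m (j + 1) - diffIter h m j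

theorem diffIter_succ' (h : ℕ → ℂ) (m : ℕ) :
    diffIter h (m + 1) = diffIter (fun j => h (j + 1) - h j) m := by
  induction m with
  | zero => rfl
  | succ m ih =>
    funext j
    change diffIter h (m + 1) (j + 1) - diffIter h (m + 1) j = _
    rw [ih]
    rfl

theorem diffIter_congr_of_forall_ge {h k : ℕ → ℂ} {N : ℕ} (hk : ∀ j ≥ N, h j = k j) (m : ℕ) :
    ∀ j ≥ N, diffIter h m j = diffIter k m j := by
  induction m with
  | zero => exact hk
  | succ m ih =>
    intro j hj
    simp only [diffIter]
    rw [ih j hj, ih (j + 1) (by omega)]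

/-- The `m`-th difference is dominated by any antitone bound for the `m`-th derivative; here
`D k` plays the role of the `k`-th derivative of `D 0`. -/
theorem norm_diffIter_le_of_hasDerivAt {a : ℝ} {g : ℝ → ℝ} (hg : AntitoneOn g (Set.Ici a))
    (m : ℕ) (D : ℕ → ℝ → ℝ) (hD : ∀ k, ∀ x ≥ a, HasDerivAt (D k) (D (k + 1) x) x)
    (hbound : ∀ x ≥ a, |D m x| ≤ g x) (j : ℕ) (hj : a ≤ j) :
    ‖diffIter (fun i => (D 0 i : ℂ)) m j‖ ≤ g j := by
  induction m generalizing D with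
  | zero => simpa [diffIter] using hbound j hj
  | succ m ih =>
    rw [diffIter_succ']
    have key := ih (fun k x => D k (x + 1) - D k x) ?_ ?_
    · simpa using key
    · intro k x hx
      exact ((hD k (x + 1) (by linarith)).comp_add_const x 1).sub (hD k x hx)
    · intro x hx
      have := (convex_Icc x (x + 1)).norm_image_sub_le_of_norm_hasDerivWithin_le
        (f := D m) (f' := D (m + 1)) (C := g x) (x := x) (y := x + 1)
        (fun y hy => (hD m y (hx.le.trans hy.1)).hasDerivWithinAt)
        (fun y hy => (hbound y (hx.le.trans hy.1)).trans
          (hg hx (hx.le.trans hy.1) hy.1))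
        (by simp) (by simp)
      simpa using this

/-- The polynomials `P k` such that the `k`-th derivative of `x⁻¹ (log x)^{-α}` is
`x^{-1-k} (log x)^{-α} P k (1 / log x)`. -/
def derivPoly (α : ℝ) : ℕ → Polynomial ℝ
  | 0 => 1
  | k + 1 => (Polynomial.C (-1 - (k : ℝ)) - Polynomial.C α * Polynomial.X) * derivPoly α k
      - Polynomial.X ^ 2 * (derivPoly α k).derivative

theorem hasDerivAt_rpow_mul_log_rpow_mul_derivPoly (α : ℝ) (k : ℕ) {x : ℝ} (hx : 1 < x) :
    HasDerivAt
      (fun x => x ^ (-1 - (k : ℝ)) * Real.log x ^ (-α) * (derivPoly α k).eval (Real.log x)⁻¹)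
      (x ^ (-1 - ((k + 1 : ℕ) : ℝ)) * Real.log x ^ (-α) *
        (derivPoly α (k + 1)).eval (Real.log x)⁻¹) x := by
  have hx0 : 0 < x := by linarith
  have hL : 0 < Real.log x := Real.log_pos hx
  have hlog := Real.hasDerivAt_log hx0.ne'
  have h1 := Real.hasDerivAt_rpow_const (x := x) (p := -1 - (k : ℝ)) (Or.inl hx0.ne')
  have h2 := hlog.rpow_const (p := -α) (Or.inl hL.ne')
  have h3 := ((derivPoly α k).hasDerivAt (Real.log x)⁻¹).comp x (hlog.inv hL.ne')
  refine ((h1.mul h2).mul h3).congr_deriv ?_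
  have e1 : x ^ (-1 - (k : ℝ)) = x ^ (-1 - (k : ℝ) - 1) * x := by
    rw [Real.rpow_sub_one hx0.ne']; field_simp
  have e2 : x ^ (-1 - ((k + 1 : ℕ) : ℝ)) = x ^ (-1 - (k : ℝ) - 1) := by
    congr 1; push_cast; ring
  simp only [derivPoly, Function.comp_apply, Pi.mul_apply, Pi.inv_apply,
    Polynomial.eval_sub, Polynomial.eval_mul,
    Polynomial.eval_C, Polynomial.eval_X, Polynomial.eval_pow]
  rw [e2, e1, Real.rpow_sub_one hL.ne']
  field_simp
  ring

theorem antitoneOn_rpow_mul_log_rpow {α : ℝ} (hα : 0 ≤ α) (m : ℕ) :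
    AntitoneOn (fun x : ℝ => x ^ (-1 - (m : ℝ)) * Real.log x ^ (-α)) (Set.Ici (Real.exp 1)) := by
  intro x hx y hy hxy
  have hx0 : 0 < x := (Real.exp_pos 1).trans_le hx
  have hL : 1 ≤ Real.log x := (Real.le_log_iff_exp_le hx0).2 hx
  have hm : (0 : ℝ) ≤ m := m.cast_nonneg
  have hlog : Real.log x ≤ Real.log y := Real.log_le_log hx0 hxy
  exact mul_le_mul (Real.rpow_le_rpow_of_nonpos hx0 hxy (by linarith))
    (Real.rpow_le_rpow_of_nonpos (by linarith) hlog (by linarith))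
    (Real.rpow_nonneg (by linarith) _) (Real.rpow_nonneg hx0.le _)

/-- **Iterated differences of the model sequence.**
If `h(j) = j⁻¹ (log j)^{-α}` for all sufficiently large `j`, then for every `m ≥ 1`,
`h^{(m)}(j) = O(j^{-1-m} (log j)^{-α})` as `j → ∞`. -/
theorem diffIter_model_sequence_bigO
    (α : ℝ) (hα : 0 < α) (h : ℕ → ℂ)
    (hh : ∀ᶠ j : ℕ in atTop, h j = ((((j : ℝ))⁻¹ * Real.log (j : ℝ) ^ (-α) : ℝ) : ℂ)) :
    ∀ m : ℕ, 1 ≤ m →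
      (fun j : ℕ => diffIter h m j) =O[atTop]
        fun j : ℕ => (j : ℝ) ^ (-1 - (m : ℝ)) * Real.log (j : ℝ) ^ (-α) := by
  intro m _
  obtain ⟨N, hN⟩ := eventually_atTop.1 hh
  obtain ⟨C, hC⟩ := (isCompact_Icc (a := (0 : ℝ)) (b := 1)).exists_bound_of_continuousOn
    (derivPoly α m).continuous.continuousOn
  have hC0 : 0 ≤ C := (norm_nonneg _).trans (hC 0 (by simp))
  have hexp : 1 < Real.exp 1 := Real.one_lt_exp_iff.2 one_pos
  refine Asymptotics.IsBigO.of_bound C ?_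
  filter_upwards [eventually_ge_atTop N,
    tendsto_natCast_atTop_atTop.eventually_ge_atTop (Real.exp 1)] with j hjN hj
  have key := norm_diffIter_le_of_hasDerivAt
    (g := fun x => C * (x ^ (-1 - (m : ℝ)) * Real.log x ^ (-α)))
    (fun x hx y hy hxy => mul_le_mul_of_nonneg_left
      (antitoneOn_rpow_mul_log_rpow hα.le m hx hy hxy) hC0) m
    (fun k x => x ^ (-1 - (k : ℝ)) * Real.log x ^ (-α) * (derivPoly α k).eval (Real.log x)⁻¹)
    (fun k x hx => hasDerivAt_rpow_mul_log_rpow_mul_derivPoly α k (hexp.trans_le hx)) ?_ j hj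
  · rw [diffIter_congr_of_forall_ge (k := fun i => _) ?_ m j hjN]
    · exact key.trans (mul_le_mul_of_nonneg_left (le_abs_self _) hC0)
    · intro i hi
      rw [hN i hi]
      simp [derivPoly, Real.rpow_neg_one]
  · intro x hx
    have hx0 : 0 < x := (Real.exp_pos 1).trans_le hx
    have hL : 1 ≤ Real.log x := (Real.le_log_iff_exp_le hx0).2 hx
    have hpos : 0 ≤ x ^ (-1 - (m : ℝ)) * Real.log x ^ (-α) :=
      mul_nonneg (Real.rpow_nonneg hx0.le _) (Real.rpow_nonneg (by linarith) _)
    rw [abs_mul, abs_of_nonneg hpos, mul_comm C]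
    exact mul_le_mul_of_nonneg_left
      (hC _ ⟨inv_nonneg.2 (by linarith), inv_le_one_of_one_le₀ hL⟩) hpos

end
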